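/- arXiv:math/0102206 — 2 statements merged into one kernel-verified Lean document; each statement's English description precedes it below -/
import Mathlib

section
/- Let d ≥ 1, let ᾱ = (α_1,...,α_d) ∈ ℝ^d, and let B > 0 be a constant such that for every real q ≥ 1 there exists a positive integer N ≤ q^d with ⟨Nᾱ⟩ < B/q. Then for every positive integer k with 5B√(k/d) ≥ 1, the discrepancy of the k-th convolution power of Q satisfies D(Q^{*k}) ≥ 0.0947 · (√d/(5B))^d · k^{−d/2}. -/
open MeasureTheory Real
open scoped ENNReal

noncomputable section

/-- The generating measure `Q` on the circle `ℝ/ℤ` of the random walk generated by the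
`d`-tuple `α`: mass `1/(2d)` at each point `α j mod 1` and `-α j mod 1`. -/
def circleQ {d : ℕ} (α : Fin d → ℝ) : Measure (AddCircle (1 : ℝ)) :=
  ((2 * d : ℝ≥0∞))⁻¹ •
    ∑ j : Fin d, (Measure.dirac ((α j : ℝ) : AddCircle (1 : ℝ)) +
      Measure.dirac (((-(α j) : ℝ)) : AddCircle (1 : ℝ)))

/-- `k`-fold convolution power of a measure on the circle. -/
def convPow (μ : Measure (AddCircle (1 : ℝ))) : ℕ → Measure (AddCircle (1 : ℝ))
  | 0 => Measure.dirac 0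
  | k + 1 => (convPow μ k).conv μ

/-- The discrepancy of a measure `P` on the circle: the supremum over all arcs
(connected subsets) `I` of `|P(I) - λ(I)|`, where `λ` is Haar (Lebesgue) probability
measure (`volume` on `AddCircle 1`). -/
def discrepancy (P : Measure (AddCircle (1 : ℝ))) : ℝ :=
  sSup { r : ℝ | ∃ I : Set (AddCircle (1 : ℝ)), IsConnected I ∧
    r = |(P I).toReal - (volume I).toReal| }

/-- The `m`-th Fourier coefficient of a measure on the circle: `∫ e^{-2πimx} dP(x)`. -/
def fourierCoeffMeasure (P : Measure (AddCircle (1 : ℝ))) (m : ℤ) : ℂ :=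
  ∫ x, fourier (-m) x ∂P

/-- Euclidean distance from `x ∈ ℝ^d` to the nearest integer lattice point. -/
def latticeDist {d : ℕ} (x : Fin d → ℝ) : ℝ :=
  ⨅ v : Fin d → ℤ, Real.sqrt (∑ i, (x i - v i) ^ 2)

instance isProbabilityMeasure_convPow (μ : Measure (AddCircle (1 : ℝ))) [IsProbabilityMeasure μ]
    (k : ℕ) : IsProbabilityMeasure (convPow μ k) := by
  induction k with
  | zero => unfold convPow; infer_instance
  | succ k ih => unfold convPow; infer_instance

lemma isProbabilityMeasure_circleQ {d : ℕ} (hd : 1 ≤ d) (α : Fin d → ℝ) :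
    IsProbabilityMeasure (circleQ α) := by
  constructor
  have h : (2 * d : ℝ≥0∞) ≠ 0 := by
    have : (d : ℝ≥0∞) ≠ 0 := by exact_mod_cast (by omega : d ≠ 0)
    simp [this]
  simp only [circleQ, Measure.smul_apply, Measure.finsetSum_apply, Measure.add_apply,
    measure_univ, Finset.sum_const, Finset.card_univ, Fintype.card_fin, smul_eq_mul, nsmul_eq_mul]
  rw [one_add_one_eq_two, mul_comm (d : ℝ≥0∞)]
  exact ENNReal.inv_mul_cancel h (by finiteness)

lemma integrable_fourier (P : Measure (AddCircle (1 : ℝ))) [IsFiniteMeasure P] (n : ℤ) :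
    Integrable (fun x => fourier n x) P :=
  (fourier n : C(AddCircle (1 : ℝ), ℂ)).continuous.integrable_of_hasCompactSupport
    (HasCompactSupport.of_compactSpace _)

lemma integral_fourier_convPow (μ : Measure (AddCircle (1 : ℝ))) [IsProbabilityMeasure μ]
    (n : ℤ) (k : ℕ) :
    ∫ x, fourier n x ∂(convPow μ k) = (∫ x, fourier n x ∂μ) ^ k := by
  induction k with
  | zero => simp [convPow]
  | succ k ih =>
    rw [convPow, integral_conv (integrable_fourier _ n), pow_succ, ← ih, ← integral_mul_const]
    refine integral_congr_ae (Filter.Eventually.of_forall fun x => ?_)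
    simp only [← integral_const_mul]
    refine integral_congr_ae (Filter.Eventually.of_forall fun y => ?_)
    simp [fourier_apply, smul_add, AddCircle.toCircle_add]

lemma integral_fourier_circleQ {d : ℕ} (α : Fin d → ℝ) (n : ℤ) :
    ∫ x, fourier n x ∂(circleQ α) =
      (((d : ℝ)⁻¹ * ∑ j, cos (2 * π * (n * α j)) : ℝ) : ℂ) := by
  rw [circleQ, integral_smul_measure, integral_finsetSum_measure
    (fun j _ => integrable_fourier _ n)]
  have h (j : Fin d) : ∫ x, fourier n x ∂(Measure.dirac ((α j : ℝ) : AddCircle (1 : ℝ)) +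
      Measure.dirac (((-(α j) : ℝ)) : AddCircle (1 : ℝ))) =
      2 * ((cos (2 * π * (n * α j)) : ℝ) : ℂ) := by
    rw [integral_add_measure (integrable_fourier _ n) (integrable_fourier _ n),
      integral_dirac, integral_dirac, fourier_coe_apply, fourier_coe_apply, Complex.ofReal_cos,
      Complex.two_cos]
    push_cast
    congr 2 <;> ring
  simp only [h]
  rw [← Finset.mul_sum, Complex.real_smul]
  simp only [ENNReal.toReal_inv, ENNReal.toReal_mul, ENNReal.toReal_ofNat, ENNReal.toReal_natCast]
  push_cast
  rw [mul_inv]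
  ring

instance isProbabilityMeasure_volume_addCircle_one :
    IsProbabilityMeasure (volume : Measure (AddCircle (1 : ℝ))) :=
  ⟨by simp [AddCircle.measure_univ]⟩

lemma abs_measureReal_sub_volume_le_discrepancy (P : Measure (AddCircle (1 : ℝ)))
    [IsProbabilityMeasure P] {I : Set (AddCircle (1 : ℝ))} (hI : IsConnected I) :
    |P.real I - volume.real I| ≤ discrepancy P := by
  refine le_csSup ⟨1, ?_⟩ ⟨I, hI, rfl⟩
  rintro _ ⟨J, -, rfl⟩
  have h1 : P.real J ≤ 1 := measureReal_le_one
  have h2 : (volume : Measure (AddCircle (1 : ℝ))).real J ≤ 1 := measureReal_le_one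
  have h3 : 0 ≤ P.real J := measureReal_nonneg
  have h4 : 0 ≤ (volume : Measure (AddCircle (1 : ℝ))).real J := measureReal_nonneg
  simp only [measureReal_def] at h1 h2 h3 h4
  rw [abs_le]
  constructor <;> linarith

/-- The `j`-th of `N` arcs of radius `θ / N` centred at the multiples of `1 / N`. -/
def equallySpacedArc (N : ℕ) (θ : ℝ) (j : Fin N) : Set (AddCircle (1 : ℝ)) :=
  (fun y : ℝ => (y : AddCircle (1 : ℝ))) '' Set.Icc ((j - θ) / N) ((j + θ) / N)

lemma isConnected_equallySpacedArc {N : ℕ} {θ : ℝ} (hθ : 0 ≤ θ) (j : Fin N) :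
    IsConnected (equallySpacedArc N θ j) := by
  refine (isConnected_Icc ?_).image _ (AddCircle.continuous_mk' _).continuousOn
  gcongr
  linarith

lemma measurableSet_equallySpacedArc (N : ℕ) (θ : ℝ) (j : Fin N) :
    MeasurableSet (equallySpacedArc N θ j) :=
  (isCompact_Icc.image (AddCircle.continuous_mk' _)).isClosed.measurableSet

lemma pairwise_disjoint_equallySpacedArc {N : ℕ} {θ : ℝ} (hθ : θ < 1 / 2) :
    Pairwise (Function.onFun Disjoint (equallySpacedArc N θ)) := by
  intro i j hij
  rw [Function.onFun, Set.disjoint_left]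
  rintro _ ⟨y, hy, rfl⟩ ⟨z, hz, hzy⟩
  refine hij (Fin.ext ?_)
  have hN : (0 : ℝ) < N := by exact_mod_cast i.pos
  obtain ⟨l, hl⟩ := AddCircle.coe_eq_zero_iff (p := (1 : ℝ)) (x := z - y) |>.1
    (by rw [AddCircle.coe_sub]; exact sub_eq_zero.2 hzy)
  rw [zsmul_eq_mul, mul_one] at hl
  rw [Set.mem_Icc, div_le_iff₀ hN, le_div_iff₀ hN] at hy hz
  have hNl : z * N - y * N = l * N := by rw [hl]; ring
  have h1 : (l * N : ℤ) - (j - i) < 1 := by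
    have : ((l * N : ℤ) - (j - i) : ℝ) < 1 := by push_cast; linarith
    exact_mod_cast this
  have h2 : (l * N : ℤ) - (j - i) > -1 := by
    have : ((l * N : ℤ) - (j - i) : ℝ) > -1 := by push_cast; linarith
    exact_mod_cast this
  have hi := i.isLt
  have hj := j.isLt
  have hl0 : l = 0 := by
    have h3 : l < 1 := by by_contra! h; nlinarith
    have h4 : -1 < l := by by_contra! h; nlinarith
    omega
  subst hl0
  omega

lemma re_fourier_coe (n : ℤ) (y : ℝ) :
    (fourier n (y : AddCircle (1 : ℝ)) : ℂ).re = cos (2 * π * (n * y)) := by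
  rw [fourier_coe_apply, ← Complex.exp_ofReal_mul_I_re]
  congr 2
  push_cast
  ring

lemma setOf_le_one_add_re_fourier {N : ℕ} (hN : 0 < N) {t : ℝ} (ht0 : 0 < t) (ht2 : t ≤ 2) :
    {x : AddCircle (1 : ℝ) | t ≤ 1 + (fourier (N : ℤ) x : ℂ).re} =
      ⋃ j, equallySpacedArc N (arccos (t - 1) / (2 * π)) j := by
  have hN' : (0 : ℝ) < N := by exact_mod_cast hN
  have hcos : cos (arccos (t - 1)) = t - 1 := cos_arccos (by linarith) (by linarith)
  have habs_cos (z : ℝ) : cos (2 * π * |z|) = cos (2 * π * z) := by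
    rw [← cos_abs (2 * π * z), abs_mul, abs_of_pos two_pi_pos]
  ext x
  rw [Set.mem_iUnion]
  constructor
  · obtain ⟨y, rfl⟩ := QuotientAddGroup.mk_surjective x
    intro h
    change t ≤ 1 + (fourier (N : ℤ) (y : AddCircle (1 : ℝ)) : ℂ).re at h
    rw [re_fourier_coe] at h
    set m : ℤ := round ((N : ℝ) * y) with hm
    have hr : |N * y - m| ≤ 1 / 2 := abs_sub_round _
    have hθ : |N * y - m| ≤ arccos (t - 1) / (2 * π) := by
      rw [le_div_iff₀ (by positivity), mul_comm,
        ← arccos_cos (x := 2 * π * |N * y - m|) (by positivity) (by nlinarith [pi_pos])]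
      refine arccos_le_arccos ?_
      have : cos (2 * π * |N * y - m|) = cos (2 * π * (((N : ℤ) : ℝ) * y)) := by
        rw [habs_cos, ← cos_sub_int_mul_two_pi (2 * π * (((N : ℤ) : ℝ) * y)) m]
        push_cast
        congr 1
        ring
      linarith
    have hmod : 0 ≤ m % N := Int.emod_nonneg _ (by omega)
    have hlt : m % N < N := Int.emod_lt_of_pos _ (by omega)
    refine ⟨⟨(m % N).toNat, by omega⟩, y - (m / N : ℤ), ?_, ?_⟩
    · have hc : (((m % N).toNat : ℕ) : ℝ) = m - N * (m / N : ℤ) := by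
        have h1 : (((m % N).toNat : ℕ) : ℤ) = m - N * (m / N) := by
          rw [Int.toNat_of_nonneg hmod, Int.emod_def]
        exact_mod_cast h1
      rw [Set.mem_Icc, div_le_iff₀ hN', le_div_iff₀ hN']
      simp only [hc]
      rw [abs_le] at hθ
      constructor <;> linarith
    · change ((y - (m / N : ℤ) : ℝ) : AddCircle (1 : ℝ)) = (y : AddCircle (1 : ℝ))
      rw [AddCircle.coe_sub, sub_eq_self, AddCircle.coe_eq_zero_iff]
      exact ⟨m / N, by simp⟩
  · rintro ⟨j, y, hy, rfl⟩
    rw [Set.mem_Icc, div_le_iff₀ hN', le_div_iff₀ hN'] at hy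
    have habs : |N * y - j| ≤ arccos (t - 1) / (2 * π) := by
      rw [abs_le]
      constructor <;> linarith
    rw [le_div_iff₀ (by positivity), mul_comm] at habs
    have h := cos_le_cos_of_nonneg_of_le_pi (by positivity) (arccos_le_pi _) habs
    rw [habs_cos, hcos] at h
    have h2 : cos (2 * π * (N * y - j)) = cos (2 * π * (((N : ℤ) : ℝ) * y)) := by
      rw [← cos_sub_nat_mul_two_pi (2 * π * (((N : ℤ) : ℝ) * y)) j]
      push_cast
      congr 1
      ring
    rw [Set.mem_ofPred_eq, re_fourier_coe, ← h2]
    linarith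

lemma measureReal_setOf_le_one_add_re_fourier_le (P : Measure (AddCircle (1 : ℝ)))
    [IsProbabilityMeasure P] {N : ℕ} (hN : 0 < N) {t : ℝ} (ht0 : 0 < t) (ht2 : t ≤ 2) :
    P.real {x | t ≤ 1 + (fourier (N : ℤ) x : ℂ).re} ≤
      volume.real {x : AddCircle (1 : ℝ) | t ≤ 1 + (fourier (N : ℤ) x : ℂ).re} +
        N * discrepancy P := by
  have hθ : arccos (t - 1) / (2 * π) < 1 / 2 := by
    rw [div_lt_iff₀ (by positivity)]
    have : arccos (t - 1) < π :=
      lt_of_le_of_ne (arccos_le_pi _) (by rw [Ne, arccos_eq_pi]; linarith)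
    linarith
  have hd := pairwise_disjoint_equallySpacedArc (N := N) hθ
  have hθ0 : 0 ≤ arccos (t - 1) / (2 * π) := div_nonneg (arccos_nonneg _) (by positivity)
  rw [setOf_le_one_add_re_fourier hN ht0 ht2,
    measureReal_iUnion_fintype hd (measurableSet_equallySpacedArc N _),
    measureReal_iUnion_fintype hd (measurableSet_equallySpacedArc N _)]
  calc _ ≤ ∑ j : Fin N, (volume.real (equallySpacedArc N (arccos (t - 1) / (2 * π)) j) +
        discrepancy P) := Finset.sum_le_sum fun j _ => by
          linarith [(abs_le.1 (abs_measureReal_sub_volume_le_discrepancy P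
            (isConnected_equallySpacedArc hθ0 j))).2]
    _ = _ := by simp [Finset.sum_add_distrib]

lemma integrableOn_measureReal_setOf_le {X : Type*} [MeasurableSpace X] (P : Measure X)
    [IsFiniteMeasure P] (f : X → ℝ) (a b : ℝ) :
    IntegrableOn (fun t => P.real {x | t ≤ f x}) (Set.Ioc a b) := by
  have h : AntitoneOn (fun t => P.real {x | t ≤ f x}) (Set.Icc a b) := fun s _ t _ hst =>
    measureReal_mono fun x (hx : t ≤ f x) => hst.trans hx
  exact (h.integrableOn_isCompact isCompact_Icc).mono_set Set.Ioc_subset_Icc_self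

lemma integral_re_fourier_le (P : Measure (AddCircle (1 : ℝ))) [IsProbabilityMeasure P]
    {N : ℕ} (hN : 0 < N) :
    ∫ x, (fourier (N : ℤ) x : ℂ).re ∂P ≤ 2 * N * discrepancy P := by
  have hint (μ : Measure (AddCircle (1 : ℝ))) [IsProbabilityMeasure μ] :
      Integrable (fun x => (fourier (N : ℤ) x : ℂ).re) μ := (integrable_fourier μ N).re
  have habs (x : AddCircle (1 : ℝ)) : |(fourier (N : ℤ) x : ℂ).re| ≤ 1 :=
    (Complex.abs_re_le_norm _).trans (by rw [fourier_apply, Circle.norm_coe])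
  have layercake (μ : Measure (AddCircle (1 : ℝ))) [IsProbabilityMeasure μ] :
      1 + ∫ x, (fourier (N : ℤ) x : ℂ).re ∂μ =
        ∫ t in Set.Ioc 0 2, μ.real {x | t ≤ 1 + (fourier (N : ℤ) x : ℂ).re} := by
    have h := ((integrable_const (1 : ℝ)).add (hint μ)).integral_eq_integral_Ioc_meas_le
      (M := 2) ?_ ?_
    · simp only [Pi.add_apply, integral_add (integrable_const (1 : ℝ)) (hint μ), integral_const,
        probReal_univ, one_smul] at h
      exact h
    · refine Filter.Eventually.of_forall fun x => ?_
      change 0 ≤ 1 + (fourier (N : ℤ) x : ℂ).re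
      linarith [(abs_le.1 (habs x)).1]
    · refine Filter.Eventually.of_forall fun x => ?_
      change 1 + (fourier (N : ℤ) x : ℂ).re ≤ 2
      linarith [(abs_le.1 (habs x)).2]
  have hvol : ∫ x : AddCircle (1 : ℝ), (fourier (N : ℤ) x : ℂ).re = 0 := by
    refine integral_eq_zero_of_add_right_eq_neg
      (g := ((1 / 2 / ((N : ℤ) : ℝ) : ℝ) : AddCircle (1 : ℝ)))
      fun x => ?_
    rw [fourier_add_half_inv_index (by exact_mod_cast hN.ne') one_pos, Complex.neg_re]
  have hconst : IntegrableOn (fun _ => N * discrepancy P) (Set.Ioc (0 : ℝ) 2) :=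
    integrableOn_const (by simp)
  have key : ∫ t in Set.Ioc 0 2, P.real {x | t ≤ 1 + (fourier (N : ℤ) x : ℂ).re} ≤
      ∫ t in Set.Ioc 0 2,
        (volume.real {x : AddCircle (1 : ℝ) | t ≤ 1 + (fourier (N : ℤ) x : ℂ).re} +
          N * discrepancy P) :=
    setIntegral_mono_on (integrableOn_measureReal_setOf_le P _ _ _)
      ((integrableOn_measureReal_setOf_le _ _ _ _).add hconst) measurableSet_Ioc
      fun t ht => measureReal_setOf_le_one_add_re_fourier_le P hN ht.1 ht.2
  rw [integral_add (integrableOn_measureReal_setOf_le _ _ _ _) hconst, ← layercake P,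
    ← layercake volume, hvol] at key
  rw [setIntegral_const, Real.volume_real_Ioc_of_le zero_le_two, smul_eq_mul] at key
  linarith

lemma one_sub_le_average_cos {d : ℕ} (hd : 1 ≤ d) {x : Fin d → ℝ} {r : ℝ}
    (hx : latticeDist x < r) :
    1 - 2 * π ^ 2 * r ^ 2 / d ≤ (d : ℝ)⁻¹ * ∑ j, cos (2 * π * x j) := by
  obtain ⟨v, hv⟩ := exists_lt_of_ciInf_lt hx
  have hd' : (0 : ℝ) < d := by exact_mod_cast hd
  have hr : ∑ i, (x i - v i) ^ 2 ≤ r ^ 2 := (lt_sq_of_sqrt_lt hv).le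
  have hcos (j : Fin d) : 1 - 2 * π ^ 2 * (x j - v j) ^ 2 ≤ cos (2 * π * x j) := by
    have h := one_sub_sq_div_two_le_cos (x := 2 * π * x j - v j * (2 * π))
    rw [cos_sub_int_mul_two_pi] at h
    linarith
  have hsum : d - 2 * π ^ 2 * r ^ 2 ≤ ∑ j, cos (2 * π * x j) := by
    calc d - 2 * π ^ 2 * r ^ 2 ≤ d - 2 * π ^ 2 * ∑ i, (x i - v i) ^ 2 := by gcongr
      _ = ∑ j, (1 - 2 * π ^ 2 * (x j - v j) ^ 2) := by
        simp [Finset.mul_sum, Finset.sum_sub_distrib]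
      _ ≤ _ := Finset.sum_le_sum fun j _ => hcos j
  calc 1 - 2 * π ^ 2 * r ^ 2 / d = (d : ℝ)⁻¹ * (d - 2 * π ^ 2 * r ^ 2) := by field_simp
    _ ≤ _ := by gcongr

/-- Lower bound on the discrepancy of the walk in terms of a Dirichlet-type
approximation constant `B` for `α`. -/
theorem discrepancy_lower_bound
    {d : ℕ} (hd : 1 ≤ d) (α : Fin d → ℝ) (B : ℝ) (hB : 0 < B)
    (hdir : ∀ q : ℝ, 1 ≤ q → ∃ N : ℕ, 0 < N ∧ (N : ℝ) ≤ q ^ (d : ℝ) ∧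
      latticeDist (fun i => (N : ℝ) * α i) < B / q)
    (k : ℕ) (hk : 0 < k) (hq : 1 ≤ 5 * B * Real.sqrt (k / d)) :
    0.0947 * (Real.sqrt d / (5 * B)) ^ d * (k : ℝ) ^ (-(d : ℝ) / 2) ≤
      discrepancy (convPow (circleQ α) k) := by
  have hd' : (0 : ℝ) < d := by exact_mod_cast hd
  have hk' : (0 : ℝ) < k := by exact_mod_cast hk
  have hk1 : (1 : ℝ) ≤ k := by exact_mod_cast hk
  set q := 5 * B * Real.sqrt (k / d) with hqdef
  have hq0 : 0 < q := by linarith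
  obtain ⟨N, hN, hNq, hdist⟩ := hdir q hq
  have hN' : (0 : ℝ) < N := by exact_mod_cast hN
  have hr : (B / q) ^ 2 = d / (25 * k) := by
    rw [hqdef, div_pow, mul_pow, sq_sqrt (by positivity)]
    field_simp
    norm_num
  have := isProbabilityMeasure_circleQ hd α
  set c := (d : ℝ)⁻¹ * ∑ j, cos (2 * π * (N * α j)) with hc
  have hpi : π ^ 2 < 10 := by nlinarith [pi_lt_d2, pi_pos]
  have hcge : 1 + -(0.8 / k) ≤ c := by
    refine le_trans ?_ (one_sub_le_average_cos hd hdist)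
    rw [hr]
    have : 2 * π ^ 2 * (d / (25 * k)) / d = (2 * π ^ 2 / 25) / k := by field_simp
    rw [this, ← sub_eq_add_neg]
    gcongr
    linarith
  have hfrac : 0.8 / (k : ℝ) ≤ 0.8 := div_le_self (by norm_num) hk1
  have hpow : (0.2 : ℝ) ≤ c ^ k :=
    calc (0.2 : ℝ) = 1 + k * -(0.8 / k) := by field_simp; norm_num
      _ ≤ (1 + -(0.8 / k)) ^ k := one_add_mul_le_pow (by linarith) k
      _ ≤ c ^ k := by gcongr; linarith
  have hint : ∫ x, (fourier (N : ℤ) x : ℂ).re ∂(convPow (circleQ α) k) = c ^ k := by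
    have h : ∫ x, (fourier (N : ℤ) x : ℂ).re ∂(convPow (circleQ α) k) =
        (∫ x, fourier (N : ℤ) x ∂(convPow (circleQ α) k)).re :=
      integral_re (integrable_fourier _ _)
    rw [h, integral_fourier_convPow, integral_fourier_circleQ, ← Complex.ofReal_pow,
      Complex.ofReal_re, Int.cast_natCast]
  have hD := integral_re_fourier_le (convPow (circleQ α) k) hN
  rw [hint] at hD
  rw [rpow_natCast] at hNq
  have hqinv : (Real.sqrt d / (5 * B)) ^ d * (k : ℝ) ^ (-(d : ℝ) / 2) = (q ^ d)⁻¹ := by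
    have h : (k : ℝ) ^ (-(d : ℝ) / 2) = (Real.sqrt k ^ d)⁻¹ := by
      rw [neg_div, rpow_neg hk'.le, sqrt_eq_rpow, ← rpow_natCast, ← rpow_mul hk'.le]
      congr 2
      ring
    have hsk : 0 < Real.sqrt k := sqrt_pos.2 hk'
    have hsd : 0 < Real.sqrt d := sqrt_pos.2 hd'
    rw [h, hqdef, sqrt_div hk'.le, ← inv_pow, ← mul_pow, ← inv_pow]
    congr 1
    field_simp
  rw [mul_assoc, hqinv]
  calc 0.0947 * (q ^ d)⁻¹ ≤ 0.0947 * (N : ℝ)⁻¹ := by gcongr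
    _ ≤ discrepancy (convPow (circleQ α) k) := by
      rw [← div_eq_mul_inv, div_le_iff₀ hN']
      linarith

end
end

section
/- Let d ≥ 1, let ᾱ ∈ ℝ^d be badly approximable with constant β > 0, let k be a positive integer, and let M = ⌊(1/2)(β² k / d³)^{d/2}⌋. Then Σ_{m=1}^{M} (1/m) · exp(−(4k/d)·⟨2mᾱ⟩²) ≤ 4.6559 / (M + 1). -/
open MeasureTheory Real
open scoped ENNReal

noncomputable section

/-- The coordinatewise rounding residue of `x` modulo the integer lattice. -/
def roundResidue {d : ℕ} (x : Fin d → ℝ) : Fin d → ℝ := fun i => x i - round (x i)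

theorem latticeDist_le_sqrt {d : ℕ} (x : Fin d → ℝ) (v : Fin d → ℤ) :
    latticeDist x ≤ √(∑ i, (x i - v i) ^ 2) :=
  ciInf_le ⟨0, by rintro _ ⟨v, rfl⟩; exact Real.sqrt_nonneg _⟩ v

theorem latticeDist_nonneg {d : ℕ} (x : Fin d → ℝ) : 0 ≤ latticeDist x :=
  le_ciInf fun _ => Real.sqrt_nonneg _

theorem latticeDist_sq_le {d : ℕ} (x : Fin d → ℝ) (v : Fin d → ℤ) :
    latticeDist x ^ 2 ≤ ∑ i, (x i - v i) ^ 2 := by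
  rw [← Real.sq_sqrt (Finset.sum_nonneg fun i _ => sq_nonneg (x i - v i))]
  exact pow_le_pow_left₀ (latticeDist_nonneg x) (latticeDist_le_sqrt x v) 2

theorem latticeDist_sq_eq {d : ℕ} (x : Fin d → ℝ) :
    latticeDist x ^ 2 = ∑ i, roundResidue x i ^ 2 := by
  refine le_antisymm (latticeDist_sq_le x fun i => round (x i)) ?_
  rw [← Real.sq_sqrt (Finset.sum_nonneg fun i _ => sq_nonneg (roundResidue x i))]
  refine pow_le_pow_left₀ (Real.sqrt_nonneg _) (le_ciInf fun v => ?_) 2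
  exact Real.sqrt_le_sqrt (Finset.sum_le_sum fun i _ => sq_le_sq.2 (round_le (x i) (v i)))

/-- The number of whole unit cells between `0` and the cell `[z, z + 1)`. -/
def cellGap : ℤ → ℕ
  | Int.ofNat n => n
  | Int.negSucc n => n

theorem cellGap_floor_sq_le (x : ℝ) : (cellGap ⌊x⌋ : ℝ) ^ 2 ≤ x ^ 2 := by
  have h1 := Int.floor_le x
  have h2 := Int.lt_floor_add_one x
  rw [sq_le_sq, Nat.abs_cast]
  generalize ⌊x⌋ = z at *
  cases z with
  | ofNat n =>
    simp only [cellGap, Int.ofNat_eq_natCast, Int.cast_natCast] at *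
    exact h1.trans (le_abs_self x)
  | negSucc n =>
    simp only [cellGap, Int.cast_negSucc] at *
    push_cast at h2
    exact le_trans (by linarith) (neg_le_abs x)

theorem sum_half_pow_cellGap_le (T : Finset ℤ) : ∑ z ∈ T, (1 / 2 : ℝ) ^ cellGap z ≤ 4 := by
  have h : HasSum (fun z : ℤ => (1 / 2 : ℝ) ^ cellGap z) (2 + 2) := by
    refine HasSum.of_nat_of_neg_add_one ?_ ?_
    · exact hasSum_geometric_two
    · have (n : ℕ) : cellGap (-((n : ℤ) + 1)) = n := by
        rw [← Int.negSucc_eq]; rfl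
      simpa only [this] using hasSum_geometric_two
  refine (sum_le_hasSum T (fun z _ => by positivity) h).trans (by norm_num)

theorem sum_prod_half_pow_cellGap_le {ι : Type*} {d : ℕ} (s : Finset ι) (c : ι → Fin d → ℤ)
    (hc : Set.InjOn c s) : ∑ m ∈ s, ∏ i, (1 / 2 : ℝ) ^ cellGap (c m i) ≤ 4 ^ d := by
  classical
  calc ∑ m ∈ s, ∏ i, (1 / 2 : ℝ) ^ cellGap (c m i)
      = ∑ z ∈ s.image c, ∏ i, (1 / 2 : ℝ) ^ cellGap (z i) :=
        (Finset.sum_image (f := fun z : Fin d → ℤ => ∏ i, (1 / 2 : ℝ) ^ cellGap (z i)) hc).symm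
    _ ≤ ∑ z ∈ Fintype.piFinset fun i => s.image fun m => c m i,
          ∏ i, (1 / 2 : ℝ) ^ cellGap (z i) := by
        refine Finset.sum_le_sum_of_subset_of_nonneg ?_ fun _ _ _ => by positivity
        intro z hz
        obtain ⟨m, hm, rfl⟩ := Finset.mem_image.1 hz
        exact Fintype.mem_piFinset.2 fun i => Finset.mem_image_of_mem _ hm
    _ = ∏ i, ∑ z ∈ s.image fun m => c m i, (1 / 2 : ℝ) ^ cellGap z :=
        (Finset.prod_univ_sum (fun i => s.image fun m => c m i)
          fun (_ : Fin d) z => (1 / 2 : ℝ) ^ cellGap z).symm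
    _ ≤ ∏ _i : Fin d, (4 : ℝ) :=
        Finset.prod_le_prod (fun _ _ => Finset.sum_nonneg fun _ _ => by positivity)
          fun _ _ => sum_half_pow_cellGap_le _
    _ = 4 ^ d := by simp

/-- Gaussian sums over a `ρ`-separated family of vectors of norm at least `ρ`. -/
theorem sum_exp_neg_sq_le_of_separated {ι : Type*} {d : ℕ} (hd : 1 ≤ d) (s : Finset ι)
    (y : ι → Fin d → ℝ) {ρ A u : ℝ} (hρ : 0 < ρ) (hu : 1 ≤ u)
    (hA : A * ρ ^ 2 = 4 * d ^ 2 * u)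
    (hnorm : ∀ m ∈ s, ρ ^ 2 ≤ ∑ i, y m i ^ 2)
    (hsep : ∀ m ∈ s, ∀ n ∈ s, m ≠ n → ρ ^ 2 ≤ ∑ i, (y m i - y n i) ^ 2) :
    ∑ m ∈ s, Real.exp (-A * ∑ i, y m i ^ 2) ≤ 4 ^ d * Real.exp (-(2 * d ^ 2 * u)) := by
  have hd1 : (1 : ℝ) ≤ d := by exact_mod_cast hd
  have hd0 : (0 : ℝ) < d := by linarith
  have : Nonempty (Fin d) := ⟨⟨0, hd⟩⟩
  have hA0 : 0 < A := by
    have : 0 < A * ρ ^ 2 := by rw [hA]; positivity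
    exact pos_of_mul_pos_left this (by positivity)
  have hsq : √(d : ℝ) ^ 2 = d := Real.sq_sqrt hd0.le
  have hsd : 0 < √(d : ℝ) := Real.sqrt_pos.2 hd0
  set c : ι → Fin d → ℤ := fun m i => ⌊√d / ρ * y m i⌋ with hc
  have hinj : Set.InjOn c s := by
    intro m hm n hn hmn
    by_contra hne
    refine (hsep m hm n hn hne).not_gt ?_
    calc ∑ i, (y m i - y n i) ^ 2 < ∑ _i : Fin d, ρ ^ 2 / d := by
          refine Finset.sum_lt_sum_of_nonempty Finset.univ_nonempty fun i _ => ?_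
          have h : |√d / ρ * y m i - √d / ρ * y n i| < 1 :=
            Int.abs_sub_lt_one_of_floor_eq_floor (congrFun hmn i)
          have h2 : (√d / ρ * y m i - √d / ρ * y n i) ^ 2 < 1 := by
            rw [sq_lt_one_iff_abs_lt_one]; exact h
          have h3 : (√d / ρ * y m i - √d / ρ * y n i) ^ 2
              = d / ρ ^ 2 * (y m i - y n i) ^ 2 := by
            rw [← mul_sub, mul_pow, div_pow, hsq]
          rw [h3] at h2
          rw [lt_div_iff₀ hd0]
          rw [div_mul_eq_mul_div, div_lt_one (by positivity)] at h2
          linarith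
      _ = ρ ^ 2 := by
          simp only [Finset.sum_const, Finset.card_univ, Fintype.card_fin, nsmul_eq_mul]
          field_simp
  have hterm : ∀ m ∈ s, Real.exp (-A * ∑ i, y m i ^ 2)
      ≤ (∏ i, (1 / 2 : ℝ) ^ cellGap (c m i)) * Real.exp (-(2 * d ^ 2 * u)) := by
    intro m hm
    have hcoord : ∀ i, (cellGap (c m i) : ℝ) ≤ A / 2 * y m i ^ 2 := by
      intro i
      have h := cellGap_floor_sq_le (√d / ρ * y m i)
      rw [mul_pow, div_pow, hsq] at h
      have hg : (cellGap (c m i) : ℝ) ≤ (cellGap (c m i) : ℝ) ^ 2 := by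
        exact_mod_cast Nat.le_self_pow two_ne_zero _
      refine hg.trans (h.trans (mul_le_mul_of_nonneg_right ?_ (sq_nonneg _)))
      rw [div_le_iff₀ (by positivity)]
      nlinarith [mul_le_mul hd1 hu zero_le_one hd0.le]
    have hexp : ∀ n : ℕ, Real.exp (-(n : ℝ)) ≤ (1 / 2 : ℝ) ^ n := by
      intro n
      have : Real.exp (-1) ≤ 1 / 2 := by
        rw [Real.exp_neg, one_div]
        exact inv_anti₀ two_pos (by linarith [Real.add_one_le_exp (1 : ℝ)])
      rw [show -(n : ℝ) = n * (-1) by ring, Real.exp_nat_mul]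
      exact pow_le_pow_left₀ (Real.exp_pos _).le this n
    calc Real.exp (-A * ∑ i, y m i ^ 2)
        ≤ Real.exp ((∑ i, -(cellGap (c m i) : ℝ)) + -(2 * d ^ 2 * u)) := by
          refine Real.exp_le_exp.2 ?_
          have h1 := Finset.sum_le_sum fun i (_ : i ∈ Finset.univ) => hcoord i
          rw [← Finset.mul_sum] at h1
          have h2 := mul_le_mul_of_nonneg_left (hnorm m hm) hA0.le
          rw [Finset.sum_neg_distrib]
          linarith
      _ = (∏ i, Real.exp (-(cellGap (c m i) : ℝ))) * Real.exp (-(2 * d ^ 2 * u)) := by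
          rw [Real.exp_add, Real.exp_sum]
      _ ≤ _ := by
          gcongr with i
          exact hexp _
  refine (Finset.sum_le_sum hterm).trans ?_
  rw [← Finset.sum_mul]
  exact mul_le_mul_of_nonneg_right (sum_prod_half_pow_cellGap_le s c hinj) (Real.exp_pos _).le

theorem four_pow_mul_exp_le {d : ℕ} (hd : 1 ≤ d) {t u : ℝ} (ht : 1 ≤ t)
    (hu : t ^ ((2 : ℝ) / d) ≤ u) : 4 ^ d * Real.exp (-(2 * d ^ 2 * u)) ≤ (t ^ 2)⁻¹ := by
  have hd1 : (1 : ℝ) ≤ d := by exact_mod_cast hd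
  have ht0 : 0 < t := by linarith
  have hlog : 0 ≤ Real.log t := Real.log_nonneg ht
  have h4 : (4 : ℝ) ^ d ≤ Real.exp (2 * d) := by
    have : (4 : ℝ) ≤ Real.exp 2 := by
      have h := Real.add_one_le_exp (1 : ℝ)
      rw [show (2 : ℝ) = 1 + 1 by norm_num, Real.exp_add]
      nlinarith
    rw [mul_comm, Real.exp_nat_mul]
    exact pow_le_pow_left₀ (by norm_num) this d
  have hu' : 1 + Real.log t * (2 / d) ≤ u := by
    rw [Real.rpow_def_of_pos ht0] at hu
    linarith [Real.add_one_le_exp (Real.log t * (2 / d))]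
  have hdu : (d : ℝ) ^ 2 + 2 * d * Real.log t ≤ d ^ 2 * u := by
    have h := mul_le_mul_of_nonneg_left hu' (sq_nonneg (d : ℝ))
    have e : (d : ℝ) ^ 2 * (1 + Real.log t * (2 / d)) = d ^ 2 + 2 * d * Real.log t := by
      field_simp
    linarith
  have hR : (t ^ 2)⁻¹ = Real.exp (-(2 * Real.log t)) := by
    rw [Real.exp_neg, two_mul, Real.exp_add, Real.exp_log ht0, sq]
  rw [hR]
  refine (mul_le_mul_of_nonneg_right h4 (Real.exp_pos _).le).trans ?_
  rw [← Real.exp_add]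
  refine Real.exp_le_exp.2 ?_
  nlinarith [mul_le_mul_of_nonneg_right hd1 hlog]

/-- Summation by parts against `1 / m` for partial sums of quadratic growth. -/
theorem sum_one_div_mul_le_of_partial_sums (a : ℕ → ℝ) (M : ℕ) {C : ℝ} (hC : 0 ≤ C)
    (h : ∀ n, 1 ≤ n → n ≤ M → ∑ m ∈ Finset.Icc 1 n, a m ≤ C * n ^ 2) (n : ℕ) (hn : n ≤ M) :
    ∑ m ∈ Finset.Icc 1 n, 1 / (m : ℝ) * a m
      ≤ (∑ m ∈ Finset.Icc 1 n, a m) / (n + 1) + C * n := by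
  induction n with
  | zero => simp
  | succ n ih =>
    have hS := h (n + 1) (by omega) hn
    have ih := ih (by omega)
    rw [Finset.sum_Icc_succ_top (by omega)] at hS ⊢
    rw [Finset.sum_Icc_succ_top (by omega)]
    generalize ∑ m ∈ Finset.Icc 1 n, a m = S at *
    push_cast at *
    have key : (S + a (n + 1)) / (n + 1) - (S + a (n + 1)) / (n + 1 + 1) ≤ C := by
      have : (S + a (n + 1)) / (n + 1) - (S + a (n + 1)) / (n + 1 + 1)
          = (S + a (n + 1)) / ((n + 1) * (n + 1 + 1)) := by field_simp; ring
      rw [this, div_le_iff₀ (by positivity)]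
      nlinarith [mul_nonneg hC (Nat.cast_nonneg (α := ℝ) n)]
    have e : 1 / ((n : ℝ) + 1) * a (n + 1) = (S + a (n + 1)) / (n + 1) - S / (n + 1) := by ring
    linarith

theorem sum_exp_latticeDist_partial_le {d : ℕ} (hd : 1 ≤ d) (α : Fin d → ℝ) {β : ℝ} (hβ : 0 < β)
    (hbad : ∀ N : ℕ, 0 < N →
      β / (N : ℝ) ^ ((1 : ℝ) / d) ≤ latticeDist (fun i => (N : ℝ) * α i))
    {k M N : ℕ} (hM : (M : ℝ) ≤ (1 / 2 : ℝ) * (β ^ 2 * k / d ^ 3) ^ ((d : ℝ) / 2))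
    (hN : 1 ≤ N) (hNM : N ≤ M) :
    ∑ m ∈ Finset.Icc 1 N,
        Real.exp (-(4 * k / d) * latticeDist (fun i => 2 * (m : ℝ) * α i) ^ 2) ≤
      ((M : ℝ) ^ 2)⁻¹ * N ^ 2 := by
  have hd0 : (0 : ℝ) < d := by exact_mod_cast hd
  have hN0 : (0 : ℝ) < N := by exact_mod_cast hN
  have ht : (1 : ℝ) ≤ M / N := by
    rw [one_le_div hN0]; exact_mod_cast hNM
  have h2N : (0 : ℝ) < 2 * N := by positivity
  set ρ : ℝ := β / (2 * N : ℝ) ^ ((1 : ℝ) / d) with hρ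
  have hρ0 : 0 < ρ := by positivity
  set u : ℝ := (β ^ 2 * k / d ^ 3) / (2 * N : ℝ) ^ ((2 : ℝ) / d) with hu
  have hX : (2 * M : ℝ) ^ ((2 : ℝ) / d) ≤ β ^ 2 * k / d ^ 3 := by
    have h : (2 * M : ℝ) ≤ (β ^ 2 * k / d ^ 3) ^ ((d : ℝ) / 2) := by linarith
    have h2 := Real.rpow_le_rpow (by positivity) h (show (0 : ℝ) ≤ 2 / d by positivity)
    rwa [← Real.rpow_mul (by positivity), show (d : ℝ) / 2 * (2 / d) = 1 by field_simp,
      Real.rpow_one] at h2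
  have htu : (M / N : ℝ) ^ ((2 : ℝ) / d) ≤ u := by
    rw [show (M / N : ℝ) = (2 * M) / (2 * N) by field_simp,
      Real.div_rpow (by positivity) h2N.le, hu]
    exact div_le_div_of_nonneg_right hX (by positivity)
  have hu1 : 1 ≤ u := (Real.one_le_rpow ht (by positivity)).trans htu
  have hpow : ((2 * N : ℝ) ^ ((1 : ℝ) / d)) ^ 2 = (2 * N : ℝ) ^ ((2 : ℝ) / d) := by
    rw [← Real.rpow_mul_natCast h2N.le]
    congr 1
    push_cast
    ring
  have hA : (4 * k / d : ℝ) * ρ ^ 2 = 4 * d ^ 2 * u := by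
    rw [hρ, hu, div_pow, hpow]
    field_simp
  have hlow : ∀ n : ℕ, 1 ≤ n → n ≤ N →
      ρ ≤ latticeDist (fun i => 2 * (n : ℝ) * α i) := by
    intro n hn hnN
    have h := hbad (2 * n) (by omega)
    push_cast at h
    refine le_trans ?_ h
    have : (0 : ℝ) < n := by exact_mod_cast hn
    rw [hρ]
    gcongr
  have hlow2 : ∀ n : ℕ, 1 ≤ n → n ≤ N →
      ρ ^ 2 ≤ latticeDist (fun i => 2 * (n : ℝ) * α i) ^ 2 := fun n hn hnN =>
    pow_le_pow_left₀ hρ0.le (hlow n hn hnN) 2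
  set y : ℕ → Fin d → ℝ := fun m => roundResidue fun i => 2 * (m : ℝ) * α i with hy
  have hsep_lt : ∀ m n : ℕ, n < m → m ≤ N → ρ ^ 2 ≤ ∑ i, (y m i - y n i) ^ 2 := by
    intro m n hnm hmN
    refine (hlow2 (m - n) (by omega) (by omega)).trans
      ((latticeDist_sq_le _ fun i =>
        round (2 * (m : ℝ) * α i) - round (2 * (n : ℝ) * α i)).trans_eq ?_)
    refine Finset.sum_congr rfl fun i _ => ?_
    simp only [hy, roundResidue]
    rw [Nat.cast_sub hnm.le]
    push_cast
    ring
  have hsum := sum_exp_neg_sq_le_of_separated hd (Finset.Icc 1 N) y hρ0 hu1 hA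
    (fun m hm => by
      rw [Finset.mem_Icc] at hm
      exact (hlow2 m hm.1 hm.2).trans_eq (latticeDist_sq_eq _))
    (fun m hm n hn hmn => by
      rw [Finset.mem_Icc] at hm hn
      rcases lt_or_gt_of_ne hmn with h | h
      · simpa only [sub_sq_comm] using hsep_lt n m h hn.2
      · exact hsep_lt m n h hm.2)
  simp only [latticeDist_sq_eq]
  refine hsum.trans ((four_pow_mul_exp_le hd ht htu).trans_eq ?_)
  rw [div_pow, inv_div]
  ring

/-- The key sum estimate: for `M = ⌊(1/2)(β²k/d³)^{d/2}⌋`, the weighted exponential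
sum is at most `4.6559/(M+1)`. -/
theorem sum_exp_latticeDist_le
    {d : ℕ} (hd : 1 ≤ d) (α : Fin d → ℝ) (β : ℝ) (hβ : 0 < β)
    (hbad : ∀ N : ℕ, 0 < N →
      β / (N : ℝ) ^ ((1 : ℝ) / d) ≤ latticeDist (fun i => (N : ℝ) * α i))
    (k : ℕ) (hk : 0 < k) (M : ℕ)
    (hM : M = ⌊(1 / 2 : ℝ) * (β ^ 2 * k / d ^ 3) ^ ((d : ℝ) / 2)⌋₊) :
    ∑ m ∈ Finset.Icc 1 M, (1 / (m : ℝ)) *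
        Real.exp (-(4 * k / d) * latticeDist (fun i => 2 * (m : ℝ) * α i) ^ 2) ≤
      4.6559 / ((M : ℝ) + 1) := by
  rcases Nat.eq_zero_or_pos M with rfl | hM0
  · norm_num
  have hM1 : (1 : ℝ) ≤ M := by exact_mod_cast hM0
  have hMle : (M : ℝ) ≤ (1 / 2 : ℝ) * (β ^ 2 * k / d ^ 3) ^ ((d : ℝ) / 2) := by
    rw [hM]
    exact Nat.floor_le (by positivity)
  have hpart : ∀ n, 1 ≤ n → n ≤ M → _ := fun n hn hnM =>
    sum_exp_latticeDist_partial_le hd α hβ hbad hMle hn hnM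
  have hMM := hpart M hM0 le_rfl
  refine (sum_one_div_mul_le_of_partial_sums _ M (by positivity) hpart M le_rfl).trans ?_
  rw [inv_mul_cancel₀ (by positivity)] at hMM
  have h2 : ((M : ℝ) ^ 2)⁻¹ * M ≤ 2 / (M + 1) := by
    rw [show ((M : ℝ) ^ 2)⁻¹ * M = 1 / M by field_simp, div_le_div_iff₀ (by positivity)
      (by positivity)]
    linarith
  calc _ ≤ 1 / ((M : ℝ) + 1) + 2 / (M + 1) := by gcongr
    _ = 3 / ((M : ℝ) + 1) := by ring
    _ ≤ 4.6559 / ((M : ℝ) + 1) := by gcongr; norm_num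

end
end
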